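/- Fix ε ∈ (0, 1/4). For every δ > 0 there is N such that the following holds for all n ≥ N with ε < x(n) < 1/2 − ε. Set r = ⌊n^{x(n)/2}⌋, n′ = n + r·a(n), let A be any integer with μ(n)/2 ≤ A ≤ 2·μ(n), and let S₁, …, S_{A+r} be fixed pairwise disjoint a(n)-element subsets of V′ = {1,…,n′}. Consider G(n′,1/2), let D be the event that S₁, …, S_{A+r} are all independent, and let Y be the number of independent a(n)-sets T of the graph with T ∉ {S₁, …, S_r} and T ∩ (S₁ ∪ … ∪ S_r) ≠ ∅. Then E[Y | D] ≤ δ. -/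

import Mathlib

open Filter
open scoped Classical

/-- A vertex set is independent if it spans no edges of the graph. -/
def IndepSet {n : ℕ} (G : SimpleGraph (Fin n)) (T : Finset (Fin n)) : Prop :=
  ∀ u ∈ T, ∀ v ∈ T, ¬ G.Adj u v

/-- `α₀(n) = 2 log₂ n − 2 log₂ log₂ n + 2 log₂ (e/2) + 1`. -/
noncomputable def alpha0 (n : ℕ) : ℝ :=
  2 * Real.logb 2 n - 2 * Real.logb 2 (Real.logb 2 n)
    + 2 * Real.logb 2 (Real.exp 1 / 2) + 1

/-- `a(n) = ⌊α₀(n)⌋`. -/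
noncomputable def aa (n : ℕ) : ℕ := ⌊alpha0 n⌋₊

/-- `μ(n) = C(n, a(n)) · 2^{−a(n)(a(n)−1)/2}`. -/
noncomputable def mu (n : ℕ) : ℝ :=
  (n.choose (aa n) : ℝ) * (2 : ℝ)⁻¹ ^ ((aa n).choose 2)

/-- `x(n) = log μ(n) / log n`, so that `μ(n) = n^{x(n)}`. -/
noncomputable def xx (n : ℕ) : ℝ := Real.log (mu n) / Real.log n

/-- The number of independent `a(n)`-sets `T` of `G` (a graph on `Fin n'`) with
`T ∉ {S₁, …, S_r}` and `T` meeting `S₁ ∪ … ∪ S_r`. -/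
noncomputable def Ycount (n n' r : ℕ) {m : ℕ} (S : Fin m → Finset (Fin n'))
    (G : SimpleGraph (Fin n')) : ℕ :=
  Nat.card {T : Finset (Fin n') // T.card = aa n ∧ IndepSet G T ∧
    (∀ i : Fin m, (i : ℕ) < r → T ≠ S i) ∧
    ∃ v ∈ T, ∃ i : Fin m, (i : ℕ) < r ∧ v ∈ S i}

/-- Pairs inside `T`. -/
def Prs {N : ℕ} (T : Finset (Fin N)) : Finset (Sym2 (Fin N)) :=
  T.offDiag.image (Function.uncurry Sym2.mk)

lemma mem_Prs {N : ℕ} (T : Finset (Fin N)) (u v : Fin N) :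
    s(u, v) ∈ Prs T ↔ u ∈ T ∧ v ∈ T ∧ u ≠ v := by
  unfold Prs
  simp only [Finset.mem_image, Finset.mem_offDiag, Prod.exists, Function.uncurry]
  constructor
  · rintro ⟨a, b, ⟨h1, h2, h3⟩, h⟩
    rcases Sym2.eq_iff.1 h with ⟨rfl, rfl⟩ | ⟨rfl, rfl⟩
    · exact ⟨h1, h2, h3⟩
    · exact ⟨h2, h1, h3.symm⟩
  · rintro ⟨h1, h2, h3⟩
    exact ⟨u, v, ⟨h1, h2, h3⟩, rfl⟩

lemma card_Prs {N : ℕ} (T : Finset (Fin N)) : (Prs T).card = T.card.choose 2 :=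
  Sym2.card_image_offDiag T

/-- Pairs inside `T` which are not inside any `S i`. -/
noncomputable def Fr {N m : ℕ} (S : Fin m → Finset (Fin N)) (T : Finset (Fin N)) :
    Finset (Sym2 (Fin N)) :=
  Prs T \ Finset.univ.biUnion fun i => Prs (S i)

lemma indep_iff {N : ℕ} (G : SimpleGraph (Fin N)) (T : Finset (Fin N)) :
    IndepSet G T ↔ ∀ u v, s(u, v) ∈ Prs T → ¬ G.Adj u v := by
  unfold IndepSet
  constructor
  · intro h u v huv
    rw [mem_Prs] at huv
    exact h u huv.1 v huv.2.1
  · intro h u hu v hv ha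
    exact h u v ((mem_Prs _ _ _).2 ⟨hu, hv, ha.ne⟩) ha

lemma count_mul {N m : ℕ} (S : Fin m → Finset (Fin N)) (T : Finset (Fin N)) :
    (Finset.univ.filter fun G : SimpleGraph (Fin N) =>
      (∀ i, IndepSet G (S i)) ∧ IndepSet G T).card * 2 ^ (Fr S T).card ≤
    (Finset.univ.filter fun G : SimpleGraph (Fin N) => ∀ i, IndepSet G (S i)).card := by
  rw [← Finset.card_powerset, ← Finset.card_product]
  refine Finset.card_le_card_of_injOn
    (fun p => p.1 ⊔ SimpleGraph.fromEdgeSet (p.2 : Set (Sym2 (Fin N)))) ?_ ?_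
  · rintro ⟨G, H⟩ hp
    simp only [Finset.coe_product, Set.mem_prod, Finset.mem_coe, Finset.mem_filter,
      Finset.mem_univ, true_and, Finset.mem_powerset] at hp ⊢
    intro i
    rw [indep_iff]
    intro u v huv hadj
    rw [SimpleGraph.sup_adj, SimpleGraph.fromEdgeSet_adj] at hadj
    rcases hadj with h | h
    · exact (indep_iff _ _).1 (hp.1.1 i) u v huv h
    · have := hp.2 h.1
      unfold Fr at this
      rw [Finset.mem_sdiff] at this
      exact this.2 (Finset.mem_biUnion.2 ⟨i, Finset.mem_univ _, huv⟩)
  · rintro ⟨G, H⟩ hp ⟨G', H'⟩ hp' heq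
    simp only [Finset.coe_product, Set.mem_prod, Finset.mem_coe, Finset.mem_filter,
      Finset.mem_univ, true_and, Finset.mem_powerset] at hp hp' heq
    have key : ∀ u v, (G.Adj u v ∨ (s(u, v) ∈ H ∧ u ≠ v)) ↔
        (G'.Adj u v ∨ (s(u, v) ∈ H' ∧ u ≠ v)) := by
      intro u v
      have := congrArg (fun K : SimpleGraph (Fin N) => K.Adj u v) heq
      simpa [SimpleGraph.sup_adj, SimpleGraph.fromEdgeSet_adj] using this
    have hH : ∀ u v, s(u, v) ∈ H → s(u, v) ∈ Prs T := fun u v h =>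
      (Finset.mem_sdiff.1 (hp.2 h)).1
    have hH' : ∀ u v, s(u, v) ∈ H' → s(u, v) ∈ Prs T := fun u v h =>
      (Finset.mem_sdiff.1 (hp'.2 h)).1
    have hG := (indep_iff _ _).1 hp.1.2
    have hG' := (indep_iff _ _).1 hp'.1.2
    have e1 : G = G' := by
      ext u v
      constructor
      · intro h
        rcases (key u v).1 (Or.inl h) with h' | h'
        · exact h'
        · exact absurd h (hG u v (hH' u v h'.1))
      · intro h
        rcases (key u v).2 (Or.inl h) with h' | h'
        · exact h'
        · exact absurd h (hG' u v (hH u v h'.1))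
    have e2 : H = H' := by
      ext e
      induction e with
      | _ u v =>
      constructor
      · intro h
        have hne := ((mem_Prs _ _ _).1 (hH u v h)).2.2
        rcases (key u v).1 (Or.inr ⟨h, hne⟩) with h' | h'
        · exact absurd h' (hG' u v (hH u v h))
        · exact h'.1
      · intro h
        have hne := ((mem_Prs _ _ _).1 (hH' u v h)).2.2
        rcases (key u v).2 (Or.inr ⟨h, hne⟩) with h' | h'
        · exact absurd h' (hG u v (hH' u v h))
        · exact h'.1
    rw [e1, e2]

/-- The relevant sets `T`. -/
noncomputable def Tset {N m : ℕ} (a r : ℕ) (S : Fin m → Finset (Fin N)) : Finset (Finset (Fin N)) :=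
  Finset.univ.filter fun T => T.card = a ∧ (∀ i : Fin m, (i : ℕ) < r → T ≠ S i) ∧
    ∃ v ∈ T, ∃ i : Fin m, (i : ℕ) < r ∧ v ∈ S i

lemma expect_le {n N m r : ℕ} (S : Fin m → Finset (Fin N)) :
    (∑' G : SimpleGraph (Fin N),
          if ∀ i, IndepSet G (S i) then (Ycount n N r S G : ℝ) else 0) /
        (Nat.card {G : SimpleGraph (Fin N) // ∀ i, IndepSet G (S i)} : ℝ) ≤
    ∑ T ∈ Tset (aa n) r S, ((2:ℝ) ^ (Fr S T).card)⁻¹ := by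
  set D := (Finset.univ.filter fun G : SimpleGraph (Fin N) => ∀ i, IndepSet G (S i)) with hD
  have hcard : Nat.card {G : SimpleGraph (Fin N) // ∀ i, IndepSet G (S i)} = D.card := by
    rw [Nat.card_eq_fintype_card, Fintype.card_subtype]
  have hY : ∀ G : SimpleGraph (Fin N), (Ycount n N r S G : ℝ) =
      ∑ T ∈ Tset (aa n) r S, if IndepSet G T then (1:ℝ) else 0 := by
    intro G
    unfold Ycount Tset
    rw [Nat.card_eq_fintype_card, Fintype.card_subtype, Finset.sum_boole, Finset.filter_filter]
    congr 2
    ext T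
    simp only [Finset.mem_filter]
    tauto
  have hpos : 0 < D.card := by
    refine Finset.card_pos.2 ⟨⊥, ?_⟩
    rw [hD, Finset.mem_filter]
    exact ⟨Finset.mem_univ _, fun i u _ v _ h => h⟩
  rw [hcard, tsum_fintype, ← Finset.sum_filter, div_le_iff₀ (by exact_mod_cast hpos)]
  simp only [hY]
  rw [Finset.sum_comm, Finset.sum_mul]
  refine Finset.sum_le_sum fun T _ => ?_
  rw [Finset.sum_boole, Finset.filter_filter, inv_mul_eq_div, le_div_iff₀ (by positivity)]
  exact_mod_cast count_mul S T

lemma Fr_card_ge1 {N m : ℕ} (S : Fin m → Finset (Fin N)) (T : Finset (Fin N)) :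
    T.card.choose 2 ≤ (Fr S T).card + ∑ i, (T ∩ S i).card.choose 2 := by
  have : Prs T ⊆ Fr S T ∪ Finset.univ.biUnion fun i => Prs (T ∩ S i) := by
    intro e
    induction e with
    | _ u v =>
    intro h
    by_cases h' : s(u,v) ∈ Finset.univ.biUnion fun i => Prs (S i)
    · obtain ⟨i, hi, h2⟩ := Finset.mem_biUnion.1 h'
      refine Finset.mem_union_right _ (Finset.mem_biUnion.2 ⟨i, hi, ?_⟩)
      rw [mem_Prs] at *
      simp only [Finset.mem_inter]
      tauto
    · exact Finset.mem_union_left _ (Finset.mem_sdiff.2 ⟨h, h'⟩)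
  rw [← card_Prs]
  refine (Finset.card_le_card this).trans ((Finset.card_union_le _ _).trans ?_)
  gcongr
  refine Finset.card_biUnion_le.trans ?_
  simp [card_Prs]

lemma Fr_card_ge2 {N m : ℕ} (S : Fin m → Finset (Fin N)) (hS : Pairwise (Function.onFun Disjoint S))
    (T : Finset (Fin N)) (j : Fin m) :
    (T ∩ S j).card * (T \ S j).card ≤ (Fr S T).card := by
  rw [← Finset.card_product]
  refine Finset.card_le_card_of_injOn (fun p => s(p.1, p.2)) ?_ ?_
  · rintro ⟨u, v⟩ h
    simp only [Finset.coe_product, Set.mem_prod, Finset.mem_coe, Finset.mem_inter,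
      Finset.mem_sdiff] at h
    refine Finset.mem_sdiff.2 ⟨(mem_Prs _ _ _).2 ⟨h.1.1, h.2.1, ?_⟩, ?_⟩
    · intro huv
      simp only at huv
      rw [huv] at h
      exact h.2.2 h.1.2
    · intro h'
      obtain ⟨i, hi, h2⟩ := Finset.mem_biUnion.1 h'
      rw [mem_Prs] at h2
      by_cases hij : i = j
      · subst hij; exact h.2.2 h2.2.1
      · exact Finset.disjoint_left.1 (hS hij) h2.1 h.1.2
  · rintro ⟨u, v⟩ h ⟨u', v'⟩ h' heq
    simp only [Finset.coe_product, Set.mem_prod, Finset.mem_coe, Finset.mem_inter,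
      Finset.mem_sdiff] at h h'
    rcases Sym2.eq_iff.1 heq with ⟨h1, h2⟩ | ⟨h1, h2⟩
    · simp only at h1 h2; rw [h1, h2]
    · simp only at h1 h2; subst h1; exact absurd h.1.2 h'.2.2

lemma large_case {N m a : ℕ} (S : Fin m → Finset (Fin N))
    (hS : Pairwise (Function.onFun Disjoint S)) (hc : ∀ i, (S i).card = a) (j : Fin m) (B : ℝ)
    (hB0 : 0 ≤ B)
    (hB : ∀ s : ℕ, 1 ≤ s → 4 * s < a → ((a:ℝ) * N) ^ s * ((2:ℝ) ^ ((a - s) * s))⁻¹ ≤ B) :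
    ∑ T ∈ (Finset.univ.filter fun T : Finset (Fin N) =>
      T.card = a ∧ T ≠ S j ∧ 3 * a < 4 * (T ∩ S j).card), ((2:ℝ) ^ (Fr S T).card)⁻¹ ≤ a * B := by
  set Q := (Finset.univ.filter fun T : Finset (Fin N) =>
      T.card = a ∧ T ≠ S j ∧ 3 * a < 4 * (T ∩ S j).card) with hQ
  set I := (Finset.Icc 1 a).filter fun s => 4 * s < a with hI
  have hmem : ∀ T ∈ Q, T.card = a ∧ T ≠ S j ∧ 3 * a < 4 * (T ∩ S j).card := by
    intro T hT
    exact (Finset.mem_filter.1 hT).2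
  have hsum : ∀ T : Finset (Fin N), (T \ S j).card + (T ∩ S j).card = T.card :=
    fun T => Finset.card_sdiff_add_card_inter _ _
  have hmap : ∀ T ∈ Q, (T \ S j).card ∈ I := by
    intro T hT
    obtain ⟨h1, h2, h3⟩ := hmem T hT
    have h4 := hsum T
    have h5 : (T \ S j).card ≠ 0 := by
      intro h0
      rw [Finset.card_eq_zero, Finset.sdiff_eq_empty_iff_subset] at h0
      exact h2 (Finset.eq_of_subset_of_card_le h0 (by rw [hc, h1]))
    rw [hI, Finset.mem_filter, Finset.mem_Icc]
    omega
  rw [← Finset.sum_fiberwise_of_maps_to hmap]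
  have hfib : ∀ s ∈ I, ∑ T ∈ Q with (T \ S j).card = s, ((2:ℝ) ^ (Fr S T).card)⁻¹ ≤ B := by
    intro s hs
    rw [hI, Finset.mem_filter, Finset.mem_Icc] at hs
    refine le_trans ?_ (hB s hs.1.1 hs.2)
    have hterm : ∀ T ∈ (Q.filter fun T => (T \ S j).card = s),
        ((2:ℝ) ^ (Fr S T).card)⁻¹ ≤ ((2:ℝ) ^ ((a - s) * s))⁻¹ := by
      intro T hT
      rw [Finset.mem_filter] at hT
      obtain ⟨h1, h2, h3⟩ := hmem T hT.1
      have h4 := hsum T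
      have h5 := Fr_card_ge2 S hS T j
      have h6 : (T ∩ S j).card = a - s := by omega
      rw [h6, hT.2] at h5
      gcongr
      norm_num
    refine (Finset.sum_le_card_nsmul _ _ _ hterm).trans ?_
    rw [nsmul_eq_mul]
    gcongr
    have hcard : (Q.filter fun T => (T \ S j).card = s).card ≤
        ((S j).powersetCard s ×ˢ (Finset.univ : Finset (Fin N)).powersetCard s).card := by
      refine Finset.card_le_card_of_injOn (fun T => (S j \ T, T \ S j)) ?_ ?_
      · intro T hT
        have hT := Finset.mem_filter.1 (Finset.mem_coe.1 hT)
        obtain ⟨h1, h2, h3⟩ := hmem T hT.1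
        have h4 := hsum T
        have h5 : (S j \ T).card + (S j ∩ T).card = (S j).card :=
          Finset.card_sdiff_add_card_inter _ _
        rw [Finset.inter_comm, hc] at h5
        simp only [Finset.coe_product, Set.mem_prod, Finset.mem_coe, Finset.mem_powersetCard]
        refine ⟨⟨Finset.sdiff_subset, by omega⟩, Finset.subset_univ _, hT.2⟩
      · intro T _ T' _ h
        simp only [Prod.mk.injEq] at h
        ext v
        have e1 := congrArg (fun X : Finset (Fin N) => v ∈ X) h.1
        have e2 := congrArg (fun X : Finset (Fin N) => v ∈ X) h.2
        simp only [Finset.mem_sdiff, eq_iff_iff] at e1 e2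
        tauto
    rw [Finset.card_product, Finset.card_powersetCard, Finset.card_powersetCard, hc,
      Finset.card_univ, Fintype.card_fin] at hcard
    have h2 : a.choose s * N.choose s ≤ (a * N) ^ s := by
      rw [mul_pow]
      exact Nat.mul_le_mul (Nat.choose_le_pow _ _) (Nat.choose_le_pow _ _)
    exact_mod_cast hcard.trans h2
  refine (Finset.sum_le_card_nsmul _ _ _ hfib).trans ?_
  rw [nsmul_eq_mul]
  gcongr
  refine (Finset.card_filter_le _ _).trans ?_
  simp

/-- Weight of a subset of a block. -/
noncomputable def wt (z : ℝ) (k : ℕ) : ℝ := z ^ k * 2 ^ (k.choose 2)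

lemma block_sum {N a : ℕ} (U : Finset (Fin N)) (hU : U.card = a) (z b : ℝ) (hb0 : 0 ≤ b)
    (hz : 0 ≤ z)
    (hb : ∀ t : ℕ, 1 ≤ t → 4 * t ≤ 3 * a → (a:ℝ) ^ t * wt z t ≤ b) :
    ∑ X ∈ U.powerset, (if 4 * X.card ≤ 3 * a ∧ 1 ≤ X.card then wt z X.card else 0) ≤ a * b := by
  rw [Finset.sum_powerset_apply_card
    (fun k => if 4 * k ≤ 3 * a ∧ 1 ≤ k then wt z k else 0), hU, Finset.sum_range_succ']
  simp only [nonpos_iff_eq_zero, one_ne_zero, and_false, if_false, smul_zero, add_zero]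
  have : ∀ k ∈ Finset.range a, (a.choose (k+1)) •
      (if 4 * (k+1) ≤ 3 * a ∧ 1 ≤ k + 1 then wt z (k+1) else 0) ≤ b := by
    intro k _
    split_ifs with h
    · refine le_trans ?_ (hb (k+1) h.2 h.1)
      rw [nsmul_eq_mul]
      have h0 : 0 ≤ wt z (k+1) := by unfold wt; positivity
      gcongr
      exact_mod_cast Nat.choose_le_pow _ _
    · simpa using hb0
  refine (Finset.sum_le_card_nsmul _ _ _ this).trans ?_
  simp

lemma small_case {N m a : ℕ} (S : Fin m → Finset (Fin N))
    (hS : Pairwise (Function.onFun Disjoint S)) (hc : ∀ i, (S i).card = a) (i0 : Fin m)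
    (z b : ℝ) (hb0 : 0 ≤ b) (hz : 0 < z)
    (hb : ∀ t : ℕ, 1 ≤ t → 4 * t ≤ 3 * a → (a:ℝ) ^ t * wt z t ≤ b) :
    ∑ T ∈ (Finset.univ.filter fun T : Finset (Fin N) =>
      T.card = a ∧ (∀ i, 4 * (T ∩ S i).card ≤ 3 * a) ∧ 1 ≤ (T ∩ S i0).card),
      ((2:ℝ) ^ (Fr S T).card)⁻¹ ≤
      ((2:ℝ) ^ (a.choose 2))⁻¹ * (z ^ a)⁻¹ * ((1 + z) ^ N * ((a * b) * (1 + a * b) ^ m)) := by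
  set Q := (Finset.univ.filter fun T : Finset (Fin N) =>
      T.card = a ∧ (∀ i, 4 * (T ∩ S i).card ≤ 3 * a) ∧ 1 ≤ (T ∩ S i0).card) with hQ
  have hmem : ∀ T ∈ Q, T.card = a ∧ (∀ i, 4 * (T ∩ S i).card ≤ 3 * a) ∧ 1 ≤ (T ∩ S i0).card :=
    fun T hT => (Finset.mem_filter.1 hT).2
  set R : Finset (Fin N) := (Finset.univ.biUnion S)ᶜ with hR
  let Bk : Option (Fin m) → Finset (Fin N) := fun o => o.elim R S
  have hBd : ∀ o o', o ≠ o' → Disjoint (Bk o) (Bk o') := by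
    have hRi : ∀ i, Disjoint R (S i) := by
      intro i
      rw [Finset.disjoint_left]
      intro v hv hv'
      rw [hR, Finset.mem_compl] at hv
      exact hv (Finset.mem_biUnion.2 ⟨i, Finset.mem_univ _, hv'⟩)
    intro o o' h
    rcases o with _ | i <;> rcases o' with _ | i'
    · exact absurd rfl h
    · exact hRi i'
    · exact (hRi i).symm
    · exact hS (fun h' => h (by rw [h']))
  have hcov : ∀ v, ∃ o, v ∈ Bk o := by
    intro v
    by_cases h : v ∈ Finset.univ.biUnion S
    · obtain ⟨i, _, hi⟩ := Finset.mem_biUnion.1 h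
      exact ⟨some i, hi⟩
    · exact ⟨none, Finset.mem_compl.2 h⟩
  have hun : ∀ T : Finset (Fin N), T = Finset.univ.biUnion fun o => T ∩ Bk o := by
    intro T
    ext v
    simp only [Finset.mem_biUnion, Finset.mem_univ, true_and, Finset.mem_inter]
    constructor
    · intro h
      obtain ⟨o, ho⟩ := hcov v
      exact ⟨o, h, ho⟩
    · rintro ⟨o, h, _⟩
      exact h
  have hcardT : ∀ T : Finset (Fin N), T.card = (T ∩ R).card + ∑ i, (T ∩ S i).card := by
    intro T
    have h1 := congrArg Finset.card (hun T)
    rw [Finset.card_biUnion, Fintype.sum_option] at h1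
    · exact h1
    · intro o _ o' _ h
      exact (hBd o o' h).mono Finset.inter_subset_right Finset.inter_subset_right
  let g : Option (Fin m) → Finset (Fin N) → ℝ := fun o X =>
    o.elim (z ^ X.card) (fun i =>
      if 4 * X.card ≤ 3 * a ∧ (i = i0 → 1 ≤ X.card) then wt z X.card else 0)
  have hwt0 : ∀ k, 0 ≤ wt z k := fun k => by unfold wt; positivity
  have hg0 : ∀ o X, 0 ≤ g o X := by
    intro o X
    rcases o with _ | i
    · exact (pow_pos hz _).le
    · simp only [g, Option.elim]
      split_ifs
      · exact hwt0 _
      · exact le_rfl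
  have hprod : ∀ T ∈ Q, ((2:ℝ) ^ (Fr S T).card)⁻¹ ≤
      ((2:ℝ) ^ (a.choose 2))⁻¹ * (z ^ a)⁻¹ * ∏ o, g o (T ∩ Bk o) := by
    intro T hT
    obtain ⟨h1, h2, h3⟩ := hmem T hT
    have e1 : ∏ o, g o (T ∩ Bk o) = z ^ a * 2 ^ (∑ i, (T ∩ S i).card.choose 2) := by
      rw [Fintype.prod_option]
      have : ∀ i : Fin m, g (some i) (T ∩ Bk (some i)) =
          z ^ (T ∩ S i).card * 2 ^ ((T ∩ S i).card.choose 2) := by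
        intro i
        simp only [g, Bk, Option.elim]
        rw [if_pos]
        · rfl
        · exact ⟨h2 i, fun h => by rw [h]; exact h3⟩
      simp only [this]
      rw [Finset.prod_mul_distrib, Finset.prod_pow_eq_pow_sum, Finset.prod_pow_eq_pow_sum,
        ← mul_assoc]
      congr 1
      simp only [g, Bk, Option.elim]
      rw [← pow_add, ← hcardT, h1]
    rw [e1]
    have e2 := Fr_card_ge1 S T
    rw [h1] at e2
    have e3 : (2:ℝ) ^ (a.choose 2) ≤ 2 ^ (Fr S T).card * 2 ^ (∑ i, (T ∩ S i).card.choose 2) := by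
      rw [← pow_add]
      exact pow_le_pow_right₀ (by norm_num) e2
    have hza : z ^ a ≠ 0 := (pow_pos hz _).ne'
    rw [mul_assoc, inv_mul_cancel_left₀ hza, inv_mul_eq_div, le_div_iff₀ (by positivity),
      inv_mul_le_iff₀ (by positivity)]
    exact e3
  refine (Finset.sum_le_sum hprod).trans ?_
  rw [← Finset.mul_sum]
  refine mul_le_mul_of_nonneg_left ?_ (by positivity)
  have hinj : Set.InjOn (fun (T : Finset (Fin N)) (o : Option (Fin m)) => T ∩ Bk o) (Q : Set (Finset (Fin N))) := by
    intro T _ T' _ h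
    have h' : ∀ o, T ∩ Bk o = T' ∩ Bk o := fun o => congrFun h o
    rw [hun T, hun T']
    simp only [h']
  have step : ∑ T ∈ Q, ∏ o, g o (T ∩ Bk o) ≤
      ∑ p ∈ Fintype.piFinset (fun o => (Bk o).powerset), ∏ o, g o (p o) := by
    rw [← Finset.sum_image (f := fun p : Option (Fin m) → Finset (Fin N) => ∏ o, g o (p o)) hinj]
    refine Finset.sum_le_sum_of_subset_of_nonneg ?_ ?_
    · intro p hp
      obtain ⟨T, _, rfl⟩ := Finset.mem_image.1 hp
      rw [Fintype.mem_piFinset]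
      intro o
      exact Finset.mem_powerset.2 Finset.inter_subset_right
    · intro p _ _
      exact Finset.prod_nonneg fun o _ => hg0 _ _
  refine step.trans ?_
  rw [← Finset.prod_univ_sum, Fintype.prod_option]
  have hq0 : 0 ≤ a * b := by positivity
  refine mul_le_mul ?_ ?_ (Finset.prod_nonneg fun i _ => Finset.sum_nonneg fun X _ => hg0 _ _)
    (by positivity)
  · have := Finset.sum_pow_mul_eq_add_pow z 1 R
    simp only [one_pow, mul_one] at this
    simp only [g, Bk, Option.elim]
    rw [this, add_comm]
    refine pow_le_pow_right₀ (by linarith) ?_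
    simpa using Finset.card_le_univ R
  · have hle : ∀ i : Fin m, ∑ X ∈ (Bk (some i)).powerset, g (some i) X ≤
        if i = i0 then a * b else 1 + a * b := by
      intro i
      have hbs := block_sum (S i) (hc i) z b hb0 hz.le hb
      split_ifs with h
      · refine le_trans (Finset.sum_le_sum fun X _ => ?_) hbs
        simp only [g, Option.elim, h, forall_true_left]
        exact le_rfl
      · have : ∑ X ∈ (S i).powerset, g (some i) X ≤ ∑ X ∈ (S i).powerset,
            ((if X = ∅ then 1 else 0) +
            (if 4 * X.card ≤ 3 * a ∧ 1 ≤ X.card then wt z X.card else 0)) := by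
          refine Finset.sum_le_sum fun X _ => ?_
          simp only [g, Option.elim, h, false_imp_iff, and_true]
          by_cases hX : X = ∅
          · subst hX
            simp [wt]
          · have : 1 ≤ X.card := Finset.card_pos.2 (Finset.nonempty_iff_ne_empty.2 hX)
            simp [hX, this]
        refine le_trans this ?_
        rw [Finset.sum_add_distrib]
        refine add_le_add ?_ hbs
        rw [Finset.sum_ite_eq' ]
        simp
    refine (Finset.prod_le_prod (fun i _ => Finset.sum_nonneg fun X _ => hg0 _ _)
      (fun i _ => hle i)).trans ?_
    rw [← Finset.mul_prod_erase Finset.univ _ (Finset.mem_univ i0), if_pos rfl]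
    refine mul_le_mul_of_nonneg_left ?_ hq0
    calc ∏ x ∈ Finset.univ.erase i0, (if x = i0 then a * b else 1 + a * b)
        ≤ ∏ x ∈ Finset.univ.erase i0, (1 + a * b) := by
          refine Finset.prod_le_prod (fun i _ => ?_) (fun i _ => ?_)
          · split_ifs <;> linarith
          · split_ifs <;> linarith
      _ = (1 + a * b) ^ (m - 1) := by
          rw [Finset.prod_const, Finset.card_erase_of_mem (Finset.mem_univ _), Finset.card_univ,
            Fintype.card_fin]
      _ ≤ _ := pow_le_pow_right₀ (by linarith) (by omega)

lemma num_large {n N a s : ℕ} {y : ℝ} (hy0 : 1 ≤ y) (hy : y ^ 4 = n) (ha : 2 ≤ a)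
    (hay : (a:ℝ) ^ 8 ≤ y) (h2a : (2:ℝ) ^ a ≤ (n:ℝ) ^ 2) (hn2 : (n:ℝ) ^ 2 ≤ 2 ^ a * (a:ℝ) ^ 2)
    (hN : (N:ℝ) ≤ 2 * n) (hs : 1 ≤ s) (hsa : 4 * s < a) :
    ((a:ℝ) * N) ^ s * ((2:ℝ) ^ ((a - s) * s))⁻¹ ≤ 4 * (a:ℝ) ^ 3 / n := by
  have hn : (0:ℝ) < n := by rw [← hy]; positivity
  have ha' : (2:ℝ) ≤ a := by exact_mod_cast ha
  have e0 : (2:ℝ) ^ (a - s) * 2 ^ s = 2 ^ a := by rw [← pow_add]; congr 1; omega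
  have e1 : ((a:ℝ) * N) / 2 ^ (a - s) ≤ 2 * a ^ 3 / n * 2 ^ s := by
    rw [div_mul_eq_mul_div, div_le_div_iff₀ (by positivity) hn]
    calc (a:ℝ) * N * n ≤ a * (2 * n) * n := by gcongr
      _ = 2 * a * (n:ℝ) ^ 2 := by ring
      _ ≤ 2 * a * (2 ^ a * (a:ℝ) ^ 2) := by gcongr
      _ = 2 * a ^ 3 * (2 ^ (a - s) * 2 ^ s) := by rw [e0]; ring
      _ = _ := by ring
  have e2 : (2:ℝ) ^ s ≤ y ^ 2 := by
    refine le_of_pow_le_pow_left₀ (n := 4) (by norm_num) (by positivity) ?_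
    calc ((2:ℝ) ^ s) ^ 4 = 2 ^ (4 * s) := by rw [← pow_mul]; congr 1; ring
      _ ≤ 2 ^ a := pow_le_pow_right₀ (by norm_num) hsa.le
      _ ≤ (n:ℝ) ^ 2 := h2a
      _ = (y ^ 2) ^ 4 := by rw [← hy]; ring
  have e3 : 4 * (a:ℝ) ^ 3 ≤ y := by
    calc 4 * (a:ℝ) ^ 3 ≤ a ^ 2 * a ^ 3 := by gcongr; nlinarith
      _ = (a:ℝ) ^ 5 := by ring
      _ ≤ (a:ℝ) ^ 8 := pow_le_pow_right₀ (by linarith) (by norm_num)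
      _ ≤ y := hay
  have e4 : 4 * (a:ℝ) ^ 3 / n * 2 ^ s ≤ 1 := by
    rw [div_mul_eq_mul_div, div_le_one hn, ← hy]
    calc 4 * (a:ℝ) ^ 3 * 2 ^ s ≤ y * y ^ 2 := by gcongr
      _ = y ^ 3 := by ring
      _ ≤ y ^ 4 := pow_le_pow_right₀ hy0 (by norm_num)
  calc ((a:ℝ) * N) ^ s * ((2:ℝ) ^ ((a - s) * s))⁻¹ = (((a:ℝ) * N) / 2 ^ (a - s)) ^ s := by
        rw [div_pow, pow_mul, div_eq_mul_inv]
    _ ≤ (2 * a ^ 3 / n * 2 ^ s) ^ s := by gcongr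
    _ = 4 * (a:ℝ) ^ 3 / n * (4 * (a:ℝ) ^ 3 / n * 2 ^ s) ^ (s - 1) := by
        obtain ⟨k, rfl⟩ : ∃ k, s = k + 1 := ⟨s - 1, by omega⟩
        simp only [Nat.add_sub_cancel]
        have h4 : 4 * (a:ℝ) ^ 3 / n = 2 * (2 * a ^ 3 / n) := by ring
        rw [h4]
        generalize 2 * (a:ℝ) ^ 3 / n = c
        rw [mul_pow, mul_pow (2 * c), mul_pow 2 c, pow_succ c, pow_succ (2 ^ (k+1))]
        ring
    _ ≤ 4 * (a:ℝ) ^ 3 / n * 1 := by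
        gcongr
        exact pow_le_one₀ (by positivity) e4
    _ = _ := mul_one _

lemma num_small {n a t : ℕ} {y : ℝ} (hy0 : 1 ≤ y) (hy : y ^ 4 = n) (ha : 2 ≤ a)
    (hay : (a:ℝ) ^ 8 ≤ y) (h2a : (2:ℝ) ^ a ≤ (n:ℝ) ^ 2) (ht : 1 ≤ t) (hta : 4 * t ≤ 3 * a) :
    (a:ℝ) ^ t * wt ((a:ℝ) / n) t ≤ (a:ℝ) ^ 2 / n := by
  have hn : (0:ℝ) < n := by rw [← hy]; positivity
  have ha' : (2:ℝ) ≤ a := by exact_mod_cast ha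
  obtain ⟨k, rfl⟩ : ∃ k, t = k + 1 := ⟨t - 1, by omega⟩
  set w : ℝ := Real.sqrt 2 ^ (k + 1) with hw
  have hw0 : 0 ≤ w := by positivity
  have hs2 : Real.sqrt 2 ^ 2 = 2 := Real.sq_sqrt (by norm_num)
  have e1 : w ^ k = 2 ^ ((k + 1).choose 2) := by
    have : (k + 1) * k = 2 * (k + 1).choose 2 := by
      rw [Nat.choose_two_right, Nat.add_sub_cancel]
      exact (Nat.mul_div_cancel' (by simpa [mul_comm] using (Nat.even_mul_succ_self k).two_dvd)).symm
    rw [hw, ← pow_mul, this, pow_mul, hs2]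
  have e2 : w ≤ y ^ 3 := by
    refine le_of_pow_le_pow_left₀ (n := 8) (by norm_num) (by positivity) ?_
    calc w ^ 8 = (Real.sqrt 2 ^ 2) ^ (4 * (k + 1)) := by
          rw [hw, ← pow_mul, ← pow_mul]; congr 1; ring
      _ = 2 ^ (4 * (k + 1)) := by rw [hs2]
      _ ≤ 2 ^ (3 * a) := pow_le_pow_right₀ (by norm_num) hta
      _ = (2 ^ a) ^ 3 := by rw [← pow_mul]; congr 1; ring
      _ ≤ ((n:ℝ) ^ 2) ^ 3 := by gcongr
      _ = (y ^ 3) ^ 8 := by rw [← hy]; ring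
  have e3 : (a:ℝ) ^ 2 ≤ y := (pow_le_pow_right₀ (by linarith) (by norm_num)).trans hay
  have e4 : (a:ℝ) ^ 2 / n * w ≤ 1 := by
    rw [div_mul_eq_mul_div, div_le_one hn, ← hy]
    calc (a:ℝ) ^ 2 * w ≤ y * y ^ 3 := by gcongr
      _ = y ^ 4 := by ring
  calc (a:ℝ) ^ (k + 1) * wt ((a:ℝ) / n) (k + 1)
      = (a:ℝ) ^ 2 / n * ((a:ℝ) ^ 2 / n * w) ^ k := by
        unfold wt
        rw [← e1, mul_pow _ w k, ← mul_assoc, ← mul_assoc, ← mul_pow, pow_succ]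
        have : (a:ℝ) * (a / n) = a ^ 2 / n := by ring
        rw [this]
        ring
    _ ≤ (a:ℝ) ^ 2 / n * 1 := by
        gcongr
        exact pow_le_one₀ (by positivity) e4
    _ = _ := mul_one _

lemma fact_bound (a : ℕ) : ((a + 1).factorial : ℝ) * Real.exp a ≤ ((a:ℝ) + 1) ^ (a + 2) := by
  induction a with
  | zero => simp
  | succ a ih =>
    have h1 : Real.exp 1 * ((a:ℝ) + 1) ^ (a + 2) ≤ ((a:ℝ) + 2) ^ (a + 2) := by
      have hx : (0:ℝ) < ((a:ℝ) + 2) / (a + 1) := by positivity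
      have h2 := Real.one_sub_inv_le_log_of_pos hx
      have h3 : 1 / ((a:ℝ) + 2) ≤ Real.log (((a:ℝ) + 2) / (a + 1)) := by
        refine le_trans (le_of_eq ?_) h2
        field_simp
        ring
      have h4 : 1 ≤ ((a + 2 : ℕ) : ℝ) * Real.log (((a:ℝ) + 2) / (a + 1)) := by
        rw [div_le_iff₀ (by positivity)] at h3
        push_cast
        linarith
      have h5 : Real.exp 1 ≤ (((a:ℝ) + 2) / (a + 1)) ^ (a + 2) := by
        rw [← Real.exp_log (pow_pos hx (a + 2)), Real.log_pow]
        exact Real.exp_le_exp.2 h4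
      rw [div_pow, le_div_iff₀ (by positivity)] at h5
      exact h5
    rw [Nat.factorial_succ]
    push_cast
    rw [Real.exp_add]
    calc ((a:ℝ) + 1 + 1) * ((a + 1).factorial : ℝ) * (Real.exp a * Real.exp 1)
        = ((a:ℝ) + 2) * (Real.exp 1 * (((a + 1).factorial : ℝ) * Real.exp a)) := by ring
      _ ≤ ((a:ℝ) + 2) * (Real.exp 1 * ((a:ℝ) + 1) ^ (a + 2)) := by gcongr
      _ ≤ ((a:ℝ) + 2) * ((a:ℝ) + 2) ^ (a + 2) := by gcongr
      _ = _ := by ring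

lemma num_choose {n a : ℕ} (ha : 1 ≤ a) (hn : 2 * a ^ 2 ≤ n) :
    (((a:ℝ) / n) ^ a)⁻¹ * Real.exp a ≤ 2 * Real.exp 1 * a * (n.choose a : ℝ) := by
  have han : a ≤ n := by nlinarith
  have ha0 : (0:ℝ) < a := by exact_mod_cast ha
  have hn0 : (0:ℝ) < n := by exact_mod_cast (by omega : 0 < n)
  have h1 : (a.factorial : ℝ) * Real.exp a ≤ Real.exp 1 * (a:ℝ) ^ (a + 1) := by
    obtain ⟨k, rfl⟩ : ∃ k, a = k + 1 := ⟨a - 1, by omega⟩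
    have := fact_bound k
    push_cast
    rw [Real.exp_add]
    calc ((k + 1).factorial : ℝ) * (Real.exp k * Real.exp 1)
        = Real.exp 1 * (((k + 1).factorial : ℝ) * Real.exp k) := by ring
      _ ≤ _ := by gcongr
  have h2 : (n:ℝ) ^ a ≤ 2 * ((a.factorial : ℝ) * n.choose a) := by
    have e1 : ((n:ℝ) - a) ^ a ≤ (a.factorial : ℝ) * n.choose a := by
      have := Nat.pow_sub_le_descFactorial n a
      rw [Nat.descFactorial_eq_factorial_mul_choose] at this
      have h' : (((n + 1 - a : ℕ) : ℝ)) ^ a ≤ (a.factorial : ℝ) * n.choose a := by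
        exact_mod_cast this
      refine le_trans ?_ h'
      have : (a:ℝ) ≤ n := by exact_mod_cast han
      rw [Nat.cast_sub (by omega)]
      push_cast
      refine pow_le_pow_left₀ (by linarith) (by linarith) _
    have e2 := one_add_mul_le_pow (a := -((a:ℝ) / n)) (by
      have : (a:ℝ) / n ≤ 1 := by rw [div_le_one hn0]; exact_mod_cast han
      linarith) a
    have e3 : (1:ℝ) / 2 ≤ 1 + a * -((a:ℝ) / n) := by
      have : (a:ℝ) * (a / n) ≤ 1 / 2 := by
        rw [mul_div_assoc', div_le_iff₀ hn0]
        have : (2:ℝ) * a ^ 2 ≤ n := by exact_mod_cast hn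
        nlinarith
      linarith
    have e4 : ((n:ℝ) - a) ^ a = (n:ℝ) ^ a * (1 + -((a:ℝ) / n)) ^ a := by
      rw [← mul_pow]
      congr 1
      field_simp
      ring
    have e5 : (n:ℝ) ^ a * (1 / 2) ≤ ((n:ℝ) - a) ^ a := by
      rw [e4]; gcongr; linarith
    linarith
  rw [div_pow, inv_div, div_mul_eq_mul_div, div_le_iff₀ (by positivity)]
  calc (n:ℝ) ^ a * Real.exp a ≤ 2 * ((a.factorial : ℝ) * n.choose a) * Real.exp a := by gcongr
    _ = 2 * n.choose a * ((a.factorial : ℝ) * Real.exp a) := by ring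
    _ ≤ 2 * n.choose a * (Real.exp 1 * (a:ℝ) ^ (a + 1)) := by gcongr
    _ = _ := by ring

lemma sum_cover {α ι : Type*} [DecidableEq α] (s : Finset α) (I : Finset ι) (t : ι → Finset α)
    (f : α → ℝ) (hf : ∀ x, 0 ≤ f x) (h : ∀ x ∈ s, ∃ i ∈ I, x ∈ t i) :
    ∑ x ∈ s, f x ≤ ∑ i ∈ I, ∑ x ∈ t i, f x := by
  calc ∑ x ∈ s, f x ≤ ∑ x ∈ s, ∑ i ∈ I, if x ∈ t i then f x else 0 := by
        refine Finset.sum_le_sum fun x hx => ?_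
        obtain ⟨i, hi, hxi⟩ := h x hx
        have := Finset.single_le_sum (f := fun i => if x ∈ t i then f x else 0)
          (fun j _ => by split_ifs; exacts [hf x, le_rfl]) hi
        simpa [hxi] using this
    _ = ∑ i ∈ I, ∑ x ∈ s, if x ∈ t i then f x else 0 := Finset.sum_comm
    _ ≤ _ := by
        refine Finset.sum_le_sum fun i _ => ?_
        rw [← Finset.sum_filter]
        refine Finset.sum_le_sum_of_subset_of_nonneg ?_ (fun x _ _ => hf x)
        intro x hx
        exact (Finset.mem_filter.1 hx).2

lemma core {n N a r m : ℕ} {y : ℝ} (hy0 : 1 ≤ y) (hy : y ^ 4 = n) (ha : 2 ≤ a)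
    (hay : (a:ℝ) ^ 8 ≤ y) (h2a : (2:ℝ) ^ a ≤ (n:ℝ) ^ 2) (hn2 : (n:ℝ) ^ 2 ≤ 2 ^ a * (a:ℝ) ^ 2)
    (hM : (n.choose a : ℝ) * (2:ℝ)⁻¹ ^ (a.choose 2) ≤ y ^ 2) (hr : (r:ℝ) ≤ y)
    (hm : (m:ℝ) ≤ 3 * y ^ 2) (hN : N = n + r * a) (S : Fin m → Finset (Fin N))
    (hc : ∀ i, (S i).card = a) (hS : Pairwise (Function.onFun Disjoint S)) :
    ∑ T ∈ Tset a r S, ((2:ℝ) ^ (Fr S T).card)⁻¹ ≤ 66 * (a:ℝ) ^ 4 / y := by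
  have hn : (0:ℝ) < n := by rw [← hy]; positivity
  have hyp : 0 < y := by linarith
  have ha' : (2:ℝ) ≤ a := by exact_mod_cast ha
  have hak : ∀ k, k ≤ 8 → (a:ℝ) ^ k ≤ y := fun k hk =>
    (pow_le_pow_right₀ (by linarith) hk).trans hay
  have hyk : ∀ k, k ≤ 4 → y ^ k ≤ n := fun k hk => by
    rw [← hy]; exact pow_le_pow_right₀ hy0 hk
  have hra2 : (r:ℝ) * a ^ 2 ≤ n := by
    calc (r:ℝ) * a ^ 2 ≤ y * y := by gcongr; exact hak 2 (by norm_num)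
      _ = y ^ 2 := by ring
      _ ≤ n := hyk 2 (by norm_num)
  have hN2 : (N:ℝ) ≤ 2 * n := by
    have : (r:ℝ) * a ≤ r * a ^ 2 := by gcongr; nlinarith
    rw [hN]; push_cast; linarith
  set z : ℝ := (a:ℝ) / n with hz
  have hz0 : 0 < z := by positivity
  set b : ℝ := (a:ℝ) ^ 2 / n with hb
  set B : ℝ := 4 * (a:ℝ) ^ 3 / n with hB
  have hb0 : 0 ≤ b := by positivity
  have hB0 : 0 ≤ B := by positivity
  let tL : Fin m → Finset (Finset (Fin N)) := fun j => Finset.univ.filter fun T =>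
      T.card = a ∧ T ≠ S j ∧ 3 * a < 4 * (T ∩ S j).card
  let tS : Fin m → Finset (Finset (Fin N)) := fun i0 => Finset.univ.filter fun T =>
      T.card = a ∧ (∀ i, 4 * (T ∩ S i).card ≤ 3 * a) ∧ 1 ≤ (T ∩ S i0).card
  let I0 : Finset (Fin m) := Finset.univ.filter fun i => (i : ℕ) < r
  let t : Fin m ⊕ Fin m → Finset (Finset (Fin N)) := Sum.elim tL tS
  have hcov := sum_cover (Tset a r S) (Finset.univ.disjSum I0) t
    (fun T => ((2:ℝ) ^ (Fr S T).card)⁻¹) (fun T => by positivity) (by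
      intro T hT
      obtain ⟨h1, h2, v, hv, i, hir, hvi⟩ := (Finset.mem_filter.1 hT).2
      by_cases hl : ∃ j, 3 * a < 4 * (T ∩ S j).card
      · obtain ⟨j, hj⟩ := hl
        refine ⟨Sum.inl j, by simp, Finset.mem_filter.2 ⟨Finset.mem_univ _, h1, ?_, hj⟩⟩
        intro hTj
        by_cases hij : i = j
        · subst hij; exact h2 i hir hTj
        · exact Finset.disjoint_left.1 (hS hij) hvi (hTj ▸ hv)
      · push Not at hl
        refine ⟨Sum.inr i, by simp [I0, hir], Finset.mem_filter.2 ⟨Finset.mem_univ _, h1, hl, ?_⟩⟩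
        exact Finset.card_pos.2 ⟨v, Finset.mem_inter.2 ⟨hv, hvi⟩⟩)
  refine hcov.trans ?_
  rw [Finset.sum_disjSum]
  simp only [t, Sum.elim_inl, Sum.elim_inr]
  have hLarge : ∑ j : Fin m, ∑ T ∈ tL j, ((2:ℝ) ^ (Fr S T).card)⁻¹ ≤ 12 * (a:ℝ) ^ 4 / y := by
    refine (Finset.sum_le_card_nsmul _ _ (a * B) fun j _ => large_case S hS hc j B hB0
      fun s hs hsa => num_large hy0 hy ha hay h2a hn2 hN2 hs hsa).trans ?_
    rw [nsmul_eq_mul, Finset.card_univ, Fintype.card_fin]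
    calc (m:ℝ) * (a * B) ≤ 3 * y ^ 2 * (a * B) := by gcongr
      _ = 12 * (a:ℝ) ^ 4 / y ^ 2 := by
          rw [hB, ← hy]; field_simp; ring
      _ ≤ 12 * (a:ℝ) ^ 4 / y := by
          gcongr
          nlinarith
  have hexp : Real.exp 1 ≤ 3 := Real.exp_one_lt_three.le
  have hone : ∀ i0 ∈ I0, ∑ T ∈ tS i0, ((2:ℝ) ^ (Fr S T).card)⁻¹ ≤ 54 * (a:ℝ) ^ 4 / y ^ 2 := by
    intro i0 _
    refine (small_case S hS hc i0 z b hb0 hz0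
      fun t ht hta => num_small hy0 hy ha hay h2a ht hta).trans ?_
    have f1 : (1 + z) ^ N ≤ Real.exp a * Real.exp 1 := by
      calc (1 + z) ^ N ≤ (Real.exp z) ^ N := by
            gcongr
            rw [add_comm]; exact Real.add_one_le_exp z
        _ = Real.exp (N * z) := (Real.exp_nat_mul z N).symm
        _ ≤ Real.exp (a + 1) := by
            refine Real.exp_le_exp.2 ?_
            rw [hN, hz]; push_cast
            rw [mul_div_assoc', div_le_iff₀ hn]
            nlinarith
        _ = _ := Real.exp_add _ _
    have f2 : (1 + a * b) ^ m ≤ Real.exp 1 := by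
      calc (1 + a * b) ^ m ≤ (Real.exp (a * b)) ^ m := by
            gcongr
            rw [add_comm]; exact Real.add_one_le_exp _
        _ = Real.exp (m * (a * b)) := (Real.exp_nat_mul _ m).symm
        _ ≤ Real.exp 1 := by
            refine Real.exp_le_exp.2 ?_
            calc (m:ℝ) * (a * b) ≤ 3 * y ^ 2 * (a * b) := by gcongr
              _ = 3 * a ^ 3 * y ^ 2 / n := by rw [hb]; ring
              _ ≤ 1 := by
                rw [div_le_one hn, ← hy]
                have : 3 * (a:ℝ) ^ 3 ≤ y := by
                  refine le_trans ?_ (hak 5 (by norm_num))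
                  calc 3 * (a:ℝ) ^ 3 ≤ a ^ 2 * a ^ 3 := by gcongr; nlinarith
                    _ = _ := by ring
                calc 3 * (a:ℝ) ^ 3 * y ^ 2 ≤ y * y ^ 2 := by gcongr
                  _ = y ^ 3 := by ring
                  _ ≤ y ^ 4 := pow_le_pow_right₀ hy0 (by norm_num)
    have f3 : (z ^ a)⁻¹ * Real.exp a ≤ 2 * Real.exp 1 * a * (n.choose a : ℝ) := by
      refine num_choose (by omega) ?_
      have : (2:ℝ) * a ^ 2 ≤ n := by
        calc (2:ℝ) * a ^ 2 ≤ a * a ^ 2 := by gcongr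
          _ = (a:ℝ) ^ 3 := by ring
          _ ≤ y := hak 3 (by norm_num)
          _ ≤ n := by simpa using hyk 1 (by norm_num)
      exact_mod_cast this
    have f4 : Real.exp 1 ^ 3 ≤ 27 := by
      calc Real.exp 1 ^ 3 ≤ 3 ^ 3 := by gcongr
        _ = 27 := by norm_num
    calc ((2:ℝ) ^ (a.choose 2))⁻¹ * (z ^ a)⁻¹ * ((1 + z) ^ N * ((a * b) * (1 + a * b) ^ m))
        ≤ ((2:ℝ) ^ (a.choose 2))⁻¹ * (z ^ a)⁻¹ *
          (Real.exp a * Real.exp 1 * ((a * b) * Real.exp 1)) := by gcongr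
      _ = ((2:ℝ) ^ (a.choose 2))⁻¹ * ((z ^ a)⁻¹ * Real.exp a) * (Real.exp 1 ^ 2 * (a * b)) := by
          ring
      _ ≤ ((2:ℝ) ^ (a.choose 2))⁻¹ * (2 * Real.exp 1 * a * (n.choose a : ℝ)) *
          (Real.exp 1 ^ 2 * (a * b)) := by gcongr
      _ = 2 * Real.exp 1 ^ 3 * (a ^ 2 * b) * ((n.choose a : ℝ) * (2:ℝ)⁻¹ ^ (a.choose 2)) := by
          rw [inv_pow]; ring
      _ ≤ 2 * 27 * (a ^ 2 * b) * y ^ 2 := by gcongr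
      _ = 54 * (a:ℝ) ^ 4 / y ^ 2 := by
          rw [hb, ← hy]; field_simp; ring
  have hI0 : (I0.card : ℝ) ≤ y := by
    refine le_trans ?_ hr
    have : I0.card ≤ (Finset.range r).card := by
      refine Finset.card_le_card_of_injOn (fun i => (i : ℕ)) ?_ ?_
      · intro i hi
        simpa [I0] using hi
      · intro i _ j _ h
        exact Fin.ext h
    rw [Finset.card_range] at this
    exact_mod_cast this
  have hSmall : ∑ i ∈ I0, ∑ T ∈ tS i, ((2:ℝ) ^ (Fr S T).card)⁻¹ ≤ 54 * (a:ℝ) ^ 4 / y := by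
    refine (Finset.sum_le_card_nsmul _ _ _ hone).trans ?_
    rw [nsmul_eq_mul]
    calc (I0.card : ℝ) * (54 * (a:ℝ) ^ 4 / y ^ 2) ≤ y * (54 * (a:ℝ) ^ 4 / y ^ 2) := by gcongr
      _ = _ := by field_simp
  calc _ ≤ 12 * (a:ℝ) ^ 4 / y + 54 * (a:ℝ) ^ 4 / y := add_le_add hLarge hSmall
    _ = _ := by ring

lemma asym (δ : ℝ) (hδ : 0 < δ) : ∀ᶠ n : ℕ in atTop,
    1 ≤ (n:ℝ) ^ (1/4 : ℝ) ∧ 2 ≤ aa n ∧ (aa n : ℝ) ^ 8 ≤ (n:ℝ) ^ (1/4 : ℝ) ∧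
    (2:ℝ) ^ (aa n) ≤ (n:ℝ) ^ 2 ∧ (n:ℝ) ^ 2 ≤ 2 ^ (aa n) * (aa n : ℝ) ^ 2 ∧
    66 * (aa n : ℝ) ^ 4 / (n:ℝ) ^ (1/4 : ℝ) ≤ δ := by
  have hlog2 : 0 < Real.log 2 := Real.log_pos (by norm_num)
  have hl : Tendsto (fun n : ℕ => Real.logb 2 (n:ℝ)) atTop atTop :=
    (Real.tendsto_logb_atTop (by norm_num)).comp tendsto_natCast_atTop_atTop
  have hk : ∀ (k : ℕ) (c : ℝ), 0 < c → ∀ᶠ n : ℕ in atTop,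
      (2 * Real.logb 2 (n:ℝ)) ^ k ≤ c * (n:ℝ) ^ (1/4 : ℝ) := by
    intro k c hc
    have h1 := (isLittleO_log_rpow_rpow_atTop (k:ℝ) (by norm_num : (0:ℝ) < 1/4))
    have h2 := h1.bound (show 0 < c * (Real.log 2 / 2) ^ k by positivity)
    have h3 := tendsto_natCast_atTop_atTop (R := ℝ) |>.eventually h2
    filter_upwards [h3, eventually_ge_atTop 1] with n hn hn1
    have hlogn : 0 ≤ Real.log n := Real.log_natCast_nonneg n
    rw [Real.rpow_natCast, Real.norm_of_nonneg (by positivity),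
      Real.norm_of_nonneg (by positivity)] at hn
    have : 2 * Real.logb 2 (n:ℝ) = Real.log n * (Real.log 2 / 2)⁻¹ := by
      unfold Real.logb; field_simp
    rw [this, mul_pow, inv_pow, ← div_eq_mul_inv, div_le_iff₀ (by positivity)]
    linarith
  filter_upwards [hl.eventually_ge_atTop 4, hk 8 1 one_pos, hk 4 (δ/66) (by positivity),
    eventually_ge_atTop 1] with n h4 h8 hδ4 hn1
  set ℓ := Real.logb 2 (n:ℝ) with hℓ
  have hn0 : (0:ℝ) < n := by exact_mod_cast hn1
  have hn1' : (1:ℝ) ≤ n := by exact_mod_cast hn1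
  have hy1 : 1 ≤ (n:ℝ) ^ (1/4 : ℝ) := Real.one_le_rpow hn1' (by norm_num)
  have hyn : (n:ℝ) ^ (1/4 : ℝ) ≤ n := by
    calc (n:ℝ) ^ (1/4 : ℝ) ≤ (n:ℝ) ^ (1 : ℝ) := Real.rpow_le_rpow_of_exponent_le hn1' (by norm_num)
      _ = n := Real.rpow_one _
  have hpow : (2:ℝ) ^ ℓ = n := Real.rpow_logb (by norm_num) (by norm_num) hn0
  have hℓ0 : 0 < ℓ := by linarith
  set lam := Real.logb 2 ℓ with hlam
  have hpowl : (2:ℝ) ^ lam = ℓ := Real.rpow_logb (by norm_num) (by norm_num) hℓ0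
  have hlam2 : 2 ≤ lam := by
    rw [hlam, Real.le_logb_iff_rpow_le (by norm_num) hℓ0]
    norm_num; linarith
  have hlaml : 2 * lam ≤ ℓ := by
    have h : ℓ ^ 2 ≤ n := by
      calc ℓ ^ 2 ≤ (2 * ℓ) ^ 2 := by gcongr; linarith
        _ ≤ (2 * ℓ) ^ 8 := pow_le_pow_right₀ (by linarith) (by norm_num)
        _ ≤ n := by linarith
    have h2 : Real.logb 2 (ℓ ^ 2) ≤ Real.logb 2 n :=
      Real.logb_le_logb_of_le (by norm_num) (by positivity) h
    rw [Real.logb_pow] at h2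
    push_cast at h2
    exact h2
  have he1 : 0 ≤ Real.logb 2 (Real.exp 1 / 2) := by
    refine Real.logb_nonneg (by norm_num) ?_
    have := Real.exp_one_gt_d9
    linarith
  have he2 : Real.logb 2 (Real.exp 1 / 2) ≤ 1 := by
    rw [Real.logb_le_iff_le_rpow (by norm_num) (by positivity)]
    have := Real.exp_one_lt_d9
    norm_num; linarith
  have hα : alpha0 n = 2 * ℓ - 2 * lam + 2 * Real.logb 2 (Real.exp 1 / 2) + 1 := rfl
  have hα0 : 0 ≤ alpha0 n := by rw [hα]; linarith
  have hup : (aa n : ℝ) ≤ 2 * ℓ := by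
    refine (Nat.floor_le hα0).trans ?_
    rw [hα]; linarith
  have hlow : 2 * ℓ - 2 * lam ≤ (aa n : ℝ) := by
    have := Nat.sub_one_lt_floor (alpha0 n)
    change alpha0 n - 1 < (aa n : ℝ) at this
    rw [hα] at this; linarith
  have hla : ℓ ≤ (aa n : ℝ) := by linarith
  have hn2 : (2:ℝ) ^ (2 * ℓ) = (n:ℝ) ^ 2 := by
    rw [mul_comm, Real.rpow_mul (by norm_num), hpow]
    exact_mod_cast Real.rpow_natCast (n:ℝ) 2
  refine ⟨hy1, ?_, ?_, ?_, ?_, ?_⟩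
  · have : (2:ℝ) ≤ aa n := by linarith
    exact_mod_cast this
  · calc (aa n : ℝ) ^ 8 ≤ (2 * ℓ) ^ 8 := by gcongr
      _ ≤ _ := by linarith
  · rw [← hn2, ← Real.rpow_natCast]
    exact Real.rpow_le_rpow_of_exponent_le (by norm_num) hup
  · have e : (2:ℝ) ^ (2 * ℓ) = (2:ℝ) ^ (2 * ℓ - 2 * lam) * ℓ ^ 2 := by
      rw [← hpowl, ← Real.rpow_natCast ((2:ℝ) ^ lam), ← Real.rpow_mul (by norm_num),
        ← Real.rpow_add (by norm_num), hpowl]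
      congr 1
      push_cast
      ring
    rw [← hn2, e, ← Real.rpow_natCast 2 (aa n)]
    gcongr
    norm_num
  · rw [div_le_iff₀ (by linarith)]
    have : (aa n : ℝ) ^ 4 ≤ (2 * ℓ) ^ 4 := by gcongr
    linarith

/-- Lemma on `E[Y ∣ D]`: conditional on all of `S₁, …, S_{A+r}` being independent,
the expected number of independent `a(n)`-sets other than `S₁, …, S_r` meeting
`S₁ ∪ … ∪ S_r` is `o(1)`. (Under the uniform measure `G(n',1/2)`, the conditional
expectation is the average of `Y` over the graphs in `D`.) -/
theorem stmt13 (ε : ℝ) (hε : 0 < ε) (hε4 : ε < 1/4) :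
    ∀ δ > (0:ℝ), ∃ N : ℕ, ∀ n ≥ N, ε < xx n → xx n < 1/2 - ε →
    ∀ A : ℕ, mu n / 2 ≤ (A : ℝ) → (A : ℝ) ≤ 2 * mu n →
    ∀ r n' : ℕ, r = ⌊(n : ℝ) ^ (xx n / 2)⌋₊ → n' = n + r * aa n →
    ∀ S : Fin (A + r) → Finset (Fin n'),
      (∀ i, (S i).card = aa n) → Pairwise (Function.onFun Disjoint S) →
      -- E[Y | D] ≤ δ
      (∑' G : SimpleGraph (Fin n'),
          if ∀ i, IndepSet G (S i) then (Ycount n n' r S G : ℝ) else 0) /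
        (Nat.card {G : SimpleGraph (Fin n') // ∀ i, IndepSet G (S i)} : ℝ) ≤ δ := by
  intro δ hδ
  obtain ⟨N, hN⟩ := eventually_atTop.1 (asym δ hδ)
  refine ⟨N, ?_⟩
  intro n hn hx1 hx2 A _ hA r n' hr hn' S hc hS
  obtain ⟨hy1, ha2, ha8, h2a, hn2, hfin⟩ := hN n hn
  refine (expect_le S).trans (le_trans ?_ hfin)
  set y : ℝ := (n:ℝ) ^ (1/4 : ℝ) with hy
  have hnn : (0:ℝ) ≤ n := Nat.cast_nonneg n
  have hy4 : y ^ 4 = n := by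
    rw [hy, ← Real.rpow_natCast, ← Real.rpow_mul hnn]
    norm_num
  have hn1 : (1:ℝ) ≤ n := by
    rw [← hy4]; exact one_le_pow₀ hy1
  have hx0 : 0 < xx n := by linarith
  have hmu0 : 0 < mu n := by
    have h0 : 0 ≤ mu n := by unfold mu; positivity
    rcases h0.eq_or_lt with h | h
    · unfold xx at hx0
      rw [← h] at hx0
      simp at hx0
    · exact h
  have hlogn : Real.log n ≠ 0 := by
    intro h
    unfold xx at hx0
    rw [h] at hx0
    simp at hx0
  have hmux : mu n = (n:ℝ) ^ (xx n) := by
    rw [Real.rpow_def_of_pos (by linarith)]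
    unfold xx
    rw [mul_div_cancel₀ _ hlogn, Real.exp_log hmu0]
  have hmu : mu n ≤ y ^ 2 := by
    rw [hmux, hy, ← Real.rpow_natCast, ← Real.rpow_mul hnn]
    refine Real.rpow_le_rpow_of_exponent_le hn1 ?_
    norm_num; linarith
  have hry : (r:ℝ) ≤ y := by
    rw [hr]
    refine (Nat.floor_le (by positivity)).trans ?_
    refine Real.rpow_le_rpow_of_exponent_le hn1 ?_
    linarith
  refine core hy1 hy4 ha2 ha8 h2a hn2 hmu hry ?_ hn' S hc hS
  push_cast
  nlinarith
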